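/- There is no polynomially length-bounded kernel reduction from the equality relation on List Bool to the equal-lengths relation on List Bool; that is, there is no function f : List Bool → List Bool together with a polynomial p : Polynomial ℕ such that (f x).length ≤ p.eval x.length for all x and, for all x y : List Bool, x = y ↔ (f x).length = (f y).length. -/

import Mathlib

theorem poly_div_two_pow_tendsto (p : Polynomial ℕ) :
    Filter.Tendsto (fun n : ℕ => ((p.eval n : ℕ) : ℝ) / 2 ^ n) Filter.atTop (nhds 0) := by
  induction p using Polynomial.induction_on' with
  | add p q hp hq =>
    have h := hp.add hq
    simp only [add_zero] at h
    refine h.congr fun n => ?_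
    rw [Polynomial.eval_add]
    push_cast
    ring
  | monomial k a =>
    have h := (tendsto_pow_const_div_const_pow_of_one_lt k (r := 2) one_lt_two).const_mul (a : ℝ)
    simp only [mul_zero] at h
    refine h.congr fun n => ?_
    rw [Polynomial.eval_monomial]
    push_cast
    ring

/-- There is no polynomially length-bounded kernel reduction from the
equality relation on binary strings to the equal-lengths relation. -/
theorem no_kernel_reduction_equality_to_equal_lengths :
    ¬ ∃ (f : List Bool → List Bool) (p : Polynomial ℕ),
        (∀ x : List Bool, (f x).length ≤ p.eval x.length) ∧
        (∀ x y : List Bool, x = y ↔ (f x).length = (f y).length) := by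
  rintro ⟨f, p, hb, hk⟩
  have key : ∀ n : ℕ, 2 ^ n ≤ (p + 1).eval n := by
    intro n
    let g : List.Vector Bool n → Fin ((p + 1).eval n) := fun v =>
      ⟨(f v.1).length, by
        have h := hb v.1
        rw [v.2] at h
        rw [Polynomial.eval_add, Polynomial.eval_one]
        omega⟩
    have hg : Function.Injective g := by
      intro v w h
      exact Subtype.ext ((hk _ _).2 (congrArg Fin.val h))
    have h := Fintype.card_le_of_injective g hg
    simpa only [card_vector, Fintype.card_bool, Fintype.card_fin] using h
  obtain ⟨n, hn⟩ := ((poly_div_two_pow_tendsto (p + 1)).eventually_lt_const one_pos).exists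
  rw [div_lt_one (by positivity)] at hn
  have h := key n
  have h2 : (p + 1).eval n < 2 ^ n := by exact_mod_cast hn
  exact absurd h (not_le.2 h2)
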